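/- (On-policy error lemma) There is a universal constant C such that in any finite Markov Game, for any two joint policies π_1 and π_2: if the advantage of π_1 is uniformly bounded, |A_{i,h}^{π_1}(s,a)| ≤ u for all i, h, s, a, and π_2 incurs on-policy error E_{s∼d^{π_2}}[ℓ_TV(π_1(s), π_2(s))] ≤ ε, then |J_i(π_1) − J_i(π_2)| ≤ C·ε·u·H for every agent i ∈ [m]. -/

import Mathlib

open scoped Classical

noncomputable section

namespace MAIL

/-- A finite Markov Game: horizon `H`, transition kernel `T`, per-agent rewards `r`,
and initial state distribution `ρ₀`.  The agents are indexed by `Fin m`, the state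
space is `S`, and agent `i` has action space `A i`; a joint action is an element of
`∀ i, A i`. -/
structure MG (m : ℕ) (S : Type) (A : Fin m → Type) where
  H : ℕ
  T : S → (∀ i, A i) → S → ℝ
  r : Fin m → S → (∀ i, A i) → ℝ
  ρ₀ : S → ℝ

variable {m : ℕ} {S : Type} {A : Fin m → Type} [Fintype S] [∀ i, Fintype (A i)]

/-- The Markov game data is valid: `ρ₀` and each `T s a` are probability
distributions, and all rewards take values in `[-1, 1]`. -/
def IsMG (G : MG m S A) : Prop :=
  (∀ s, 0 ≤ G.ρ₀ s) ∧ (∑ s, G.ρ₀ s) = 1 ∧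
  (∀ s a, (∀ s', 0 ≤ G.T s a s') ∧ (∑ s', G.T s a s') = 1) ∧
  (∀ i s a, |G.r i s a| ≤ 1)

/-- A (mediator or joint) policy is a stochastic map from states to joint actions.
When all agents obediently follow the mediator policy `σ`, the induced joint policy
`π_σ` is `σ` itself. -/
def IsPolicy (π : S → (∀ i, A i) → ℝ) : Prop :=
  ∀ s, (∀ a, 0 ≤ π s a) ∧ (∑ a, π s a) = 1

/-- Distribution over states at (0-indexed) step `h` under joint policy `π`. -/
def stateDist (G : MG m S A) (π : S → (∀ i, A i) → ℝ) : ℕ → S → ℝ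
  | 0 => G.ρ₀
  | h + 1 => fun s' => ∑ s, ∑ a, stateDist G π h s * π s a * G.T s a s'

/-- Expected cumulative reward over horizon `G.H` of joint policy `π` when every
agent's reward function is `f`, i.e. `J(π, f)`. -/
def Jf (G : MG m S A) (π : S → (∀ i, A i) → ℝ) (f : S → (∀ i, A i) → ℝ) : ℝ :=
  ∑ h ∈ Finset.range G.H, ∑ s, ∑ a, stateDist G π h s * π s a * f s a

/-- Value `J_i(π)` of joint policy `π` for agent `i` under the true rewards. -/
def J (G : MG m S A) (i : Fin m) (π : S → (∀ i, A i) → ℝ) : ℝ :=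
  Jf G π (G.r i)

/-- Occupancy measure `ρ^π(s, a) = (1/H) ∑_h Pr_π(s_h = s, a_h = a)`. -/
def occ (G : MG m S A) (π : S → (∀ i, A i) → ℝ) (s : S) (a : ∀ i, A i) : ℝ :=
  (∑ h ∈ Finset.range G.H, stateDist G π h s * π s a) / G.H

/-- Average state visitation distribution `d^π(s) = ∑_a ρ^π(s, a)`. -/
def dAvg (G : MG m S A) (π : S → (∀ i, A i) → ℝ) (s : S) : ℝ :=
  ∑ a, occ G π s a

/-- The joint policy `π_{σ, φ_i}` obtained from mediator policy `σ` when agent `i`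
deviates via `φ : S → A i → A i` (playing `φ s a` when recommended `a` at state `s`)
while all other agents follow their recommendations. -/
def dev (σ : S → (∀ i, A i) → ℝ) (i : Fin m) (φ : S → A i → A i) :
    S → (∀ i, A i) → ℝ :=
  fun s b => ∑ a : ∀ j, A j, if Function.update a i (φ s (a i)) = b then σ s a else 0

/-- Regret `R_Φ(σ, f)` of mediator policy `σ` w.r.t. deviation classes `Φ`, when
`f` is used as every agent's reward function. -/
def regretF (G : MG m S A) (σ : S → (∀ i, A i) → ℝ)
    (Φ : ∀ i : Fin m, Set (S → A i → A i)) (f : S → (∀ i, A i) → ℝ) : ℝ :=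
  ⨆ i : Fin m, ⨆ φ : Φ i, (Jf G (dev σ i φ.1) f - Jf G σ f)

/-- Regret `R_Φ(σ)` of mediator policy `σ` under the true rewards. -/
def regret (G : MG m S A) (σ : S → (∀ i, A i) → ℝ)
    (Φ : ∀ i : Fin m, Set (S → A i → A i)) : ℝ :=
  ⨆ i : Fin m, ⨆ φ : Φ i, (J G i (dev σ i φ.1) - J G i σ)

/-- Value-to-go `V` of joint policy `π` with `k` steps remaining (so the value from
step `h` in the paper corresponds to `k = H - h` remaining steps), with every
agent's reward given by `f`. -/
def Vgo (G : MG m S A) (f : S → (∀ i, A i) → ℝ) (π : S → (∀ i, A i) → ℝ) :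
    ℕ → S → ℝ
  | 0 => fun _ => 0
  | k + 1 => fun s => ∑ a, π s a * (f s a + ∑ s', G.T s a s' * Vgo G f π k s')

/-- Q-value of joint policy `π` with `k` steps remaining. -/
def Qgo (G : MG m S A) (f : S → (∀ i, A i) → ℝ) (π : S → (∀ i, A i) → ℝ)
    (k : ℕ) (s : S) (a : ∀ i, A i) : ℝ :=
  match k with
  | 0 => 0
  | k + 1 => f s a + ∑ s', G.T s a s' * Vgo G f π k s'

/-- Advantage `A = Q - V` of joint policy `π` with `k` steps remaining. -/
def Adv (G : MG m S A) (f : S → (∀ i, A i) → ℝ) (π : S → (∀ i, A i) → ℝ)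
    (k : ℕ) (s : S) (a : ∀ i, A i) : ℝ :=
  Qgo G f π k s a - Vgo G f π k s

/-- `u`-recoverability: the advantage of any expert-plus-single-deviation joint
policy `π_{σ_E, φ_i}` is bounded by `u` at every state, joint action, and step. -/
def Recoverable (G : MG m S A) (Φ : ∀ i : Fin m, Set (S → A i → A i))
    (σE : S → (∀ i, A i) → ℝ) (u : ℝ) : Prop :=
  ∀ i : Fin m, ∀ φ ∈ Φ i, ∀ k ≤ G.H, ∀ s a, |Adv G (G.r i) (dev σE i φ) k s a| ≤ u

/-- `β`-coverage: the expert's average state distribution puts mass at least `β`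
on every state. -/
def Coverage (G : MG m S A) (σE : S → (∀ i, A i) → ℝ) (β : ℝ) : Prop :=
  ∀ s, β ≤ dAvg G σE s

/-- Total variation distance between two finitely supported distributions. -/
def tv {α : Type} [Fintype α] (p q : α → ℝ) : ℝ :=
  (∑ a, |p a - q a|) / 2

theorem stateDist_nonneg {G : MG m S A} (hG : IsMG G) {π : S → (∀ i, A i) → ℝ}
    (hπ : IsPolicy π) (h : ℕ) (s : S) : 0 ≤ stateDist G π h s := by
  induction h generalizing s with
  | zero => exact hG.1 s
  | succ h ih =>
    exact Finset.sum_nonneg fun t _ => Finset.sum_nonneg fun a _ =>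
      mul_nonneg (mul_nonneg (ih t) ((hπ t).1 a)) ((hG.2.2.1 t a).1 s)

theorem sum_stateDist_succ_mul (G : MG m S A) (π : S → (∀ i, A i) → ℝ) (h : ℕ) (v : S → ℝ) :
    ∑ s', stateDist G π (h + 1) s' * v s' =
      ∑ s, ∑ a, stateDist G π h s * π s a * ∑ s', G.T s a s' * v s' := by
  simp only [stateDist, Finset.sum_mul, Finset.mul_sum]
  rw [Finset.sum_comm]
  refine Finset.sum_congr rfl fun s _ => ?_
  rw [Finset.sum_comm]
  exact Finset.sum_congr rfl fun a _ => Finset.sum_congr rfl fun s' _ => by ring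

/-- The expected advantage of a policy under itself vanishes. -/
theorem sum_mul_Adv_self (G : MG m S A) (f : S → (∀ i, A i) → ℝ) {π : S → (∀ i, A i) → ℝ}
    (hπ : IsPolicy π) (k : ℕ) (s : S) : ∑ a, π s a * Adv G f π k s a = 0 := by
  simp only [Adv, mul_sub, Finset.sum_sub_distrib, ← Finset.sum_mul, (hπ s).2, one_mul]
  cases k <;> simp [Qgo, Vgo]

/-- One step of the performance difference identity. -/
theorem sum_stateDist_mul_Adv (G : MG m S A) (f : S → (∀ i, A i) → ℝ)
    (π₁ : S → (∀ i, A i) → ℝ) {π₂ : S → (∀ i, A i) → ℝ} (hπ₂ : IsPolicy π₂) (h k : ℕ) :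
    ∑ s, ∑ a, stateDist G π₂ h s * π₂ s a * Adv G f π₁ (k + 1) s a =
      (∑ s, ∑ a, stateDist G π₂ h s * π₂ s a * f s a) +
        ((∑ s, stateDist G π₂ (h + 1) s * Vgo G f π₁ k s) -
          ∑ s, stateDist G π₂ h s * Vgo G f π₁ (k + 1) s) := by
  have hV : ∑ s, stateDist G π₂ h s * Vgo G f π₁ (k + 1) s =
      ∑ s, ∑ a, stateDist G π₂ h s * π₂ s a * Vgo G f π₁ (k + 1) s := by
    refine Finset.sum_congr rfl fun s _ => ?_
    rw [← Finset.sum_mul, ← Finset.mul_sum, (hπ₂ s).2, mul_one]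
  rw [hV, sum_stateDist_succ_mul]
  simp only [← Finset.sum_add_distrib, ← Finset.sum_sub_distrib]
  refine Finset.sum_congr rfl fun s _ => Finset.sum_congr rfl fun a _ => ?_
  simp only [Adv, Qgo]
  ring

/-- The performance difference identity: the return of `π₂` exceeds the value of `π₁` by the
expected cumulative advantage of `π₁` along trajectories of `π₂`. -/
theorem Jf_eq_sum_Vgo_add_sum_Adv (G : MG m S A) (f : S → (∀ i, A i) → ℝ)
    (π₁ : S → (∀ i, A i) → ℝ) {π₂ : S → (∀ i, A i) → ℝ} (hπ₂ : IsPolicy π₂) :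
    Jf G π₂ f = (∑ s, G.ρ₀ s * Vgo G f π₁ G.H s) +
      ∑ h ∈ Finset.range G.H, ∑ s, ∑ a,
        stateDist G π₂ h s * π₂ s a * Adv G f π₁ (G.H - h) s a := by
  have hstep : ∀ h ∈ Finset.range G.H,
      ∑ s, ∑ a, stateDist G π₂ h s * π₂ s a * Adv G f π₁ (G.H - h) s a =
        (∑ s, ∑ a, stateDist G π₂ h s * π₂ s a * f s a) +
          ((∑ s, stateDist G π₂ (h + 1) s * Vgo G f π₁ (G.H - (h + 1)) s) -
            ∑ s, stateDist G π₂ h s * Vgo G f π₁ (G.H - h) s) := by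
    intro h hh
    have hk : G.H - h = G.H - (h + 1) + 1 := by
      have := Finset.mem_range.1 hh
      omega
    rw [hk]
    exact sum_stateDist_mul_Adv G f π₁ hπ₂ h _
  rw [Finset.sum_congr rfl hstep, Finset.sum_add_distrib,
    Finset.sum_range_sub fun h => ∑ s, stateDist G π₂ h s * Vgo G f π₁ (G.H - h) s]
  simp [Jf, stateDist, Vgo]

theorem Jf_sub_Jf (G : MG m S A) (f : S → (∀ i, A i) → ℝ) {π₁ π₂ : S → (∀ i, A i) → ℝ}
    (hπ₁ : IsPolicy π₁) (hπ₂ : IsPolicy π₂) :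
    Jf G π₁ f - Jf G π₂ f = ∑ h ∈ Finset.range G.H, ∑ s, stateDist G π₂ h s *
      ∑ a, (π₁ s a - π₂ s a) * Adv G f π₁ (G.H - h) s a := by
  rw [Jf_eq_sum_Vgo_add_sum_Adv G f π₁ hπ₁, Jf_eq_sum_Vgo_add_sum_Adv G f π₁ hπ₂]
  simp only [mul_assoc, ← Finset.mul_sum, sub_mul, Finset.sum_sub_distrib,
    sum_mul_Adv_self G f hπ₁]
  simp

theorem dAvg_mul_horizon (G : MG m S A) {π : S → (∀ i, A i) → ℝ} (hπ : IsPolicy π) (s : S) :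
    dAvg G π s * G.H = ∑ h ∈ Finset.range G.H, stateDist G π h s := by
  by_cases hH : (G.H : ℝ) = 0
  · have : G.H = 0 := by exact_mod_cast hH
    simp [this]
  · simp only [dAvg, occ, ← Finset.sum_div]
    rw [div_mul_cancel₀ _ hH, Finset.sum_comm]
    simp only [← Finset.mul_sum, (hπ s).2, mul_one]

theorem abs_sum_sub_mul_le_tv {α : Type} [Fintype α] (p q g : α → ℝ) {u : ℝ}
    (hg : ∀ a, |g a| ≤ u) : |∑ a, (p a - q a) * g a| ≤ 2 * u * tv p q := by
  calc |∑ a, (p a - q a) * g a| ≤ ∑ a, |(p a - q a) * g a| := Finset.abs_sum_le_sum_abs _ _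
    _ ≤ ∑ a, |p a - q a| * u := Finset.sum_le_sum fun a _ => by
        rw [abs_mul]
        exact mul_le_mul_of_nonneg_left (hg a) (abs_nonneg _)
    _ = 2 * u * tv p q := by
        rw [← Finset.sum_mul, tv]
        ring

/-- **On-policy error lemma.** There is a universal constant `C`
such that in any finite Markov Game, for joint policies `π₁, π₂`: if the advantage
of `π₁` is uniformly bounded by `u` and `π₂` incurs on-policy error
`E_{s ∼ d^{π₂}}[ℓ_TV(π₁(s), π₂(s))] ≤ ε`, then `|J_i(π₁) − J_i(π₂)| ≤ C·ε·u·H`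
for every agent `i`. -/
theorem on_policy_error_lemma :
    ∃ C : ℝ, 0 < C ∧
      ∀ (m : ℕ) (S : Type) (A : Fin m → Type) [Fintype S] [∀ i, Fintype (A i)]
        (G : MG m S A), IsMG G →
        ∀ (π₁ π₂ : S → (∀ i, A i) → ℝ), IsPolicy π₁ → IsPolicy π₂ →
        ∀ (u ε : ℝ),
        (∀ i : Fin m, ∀ k ≤ G.H, ∀ s a, |Adv G (G.r i) π₁ k s a| ≤ u) →
        (∑ s, dAvg G π₂ s * tv (π₁ s) (π₂ s)) ≤ ε →
        ∀ i : Fin m, |J G i π₁ - J G i π₂| ≤ C * ε * u * G.H := by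
  refine ⟨2, two_pos, ?_⟩
  intro m S A _ _ G hG π₁ π₂ hπ₁ hπ₂ u ε hu hε i
  have hu₀ : 0 ≤ u := by
    obtain ⟨s, -, -⟩ := Finset.exists_ne_zero_of_sum_ne_zero
      (by rw [hG.2.1]; exact one_ne_zero : ∑ s, G.ρ₀ s ≠ 0)
    obtain ⟨a, -, -⟩ := Finset.exists_ne_zero_of_sum_ne_zero
      (by rw [(hπ₁ s).2]; exact one_ne_zero : ∑ a, π₁ s a ≠ 0)
    exact (abs_nonneg _).trans (hu i 0 (Nat.zero_le _) s a)
  have hpoint : ∀ h s, |stateDist G π₂ h s *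
      ∑ a, (π₁ s a - π₂ s a) * Adv G (G.r i) π₁ (G.H - h) s a| ≤
        stateDist G π₂ h s * (2 * u * tv (π₁ s) (π₂ s)) := by
    intro h s
    rw [abs_mul, abs_of_nonneg (stateDist_nonneg hG hπ₂ h s)]
    exact mul_le_mul_of_nonneg_left
      (abs_sum_sub_mul_le_tv _ _ _ fun a => hu i _ (Nat.sub_le _ _) s a)
      (stateDist_nonneg hG hπ₂ h s)
  rw [J, J, Jf_sub_Jf G (G.r i) hπ₁ hπ₂]
  calc
    _ ≤ ∑ h ∈ Finset.range G.H, ∑ s, stateDist G π₂ h s * (2 * u * tv (π₁ s) (π₂ s)) :=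
      (Finset.abs_sum_le_sum_abs _ _).trans <| Finset.sum_le_sum fun h _ =>
        (Finset.abs_sum_le_sum_abs _ _).trans <| Finset.sum_le_sum fun s _ => hpoint h s
    _ = 2 * u * G.H * ∑ s, dAvg G π₂ s * tv (π₁ s) (π₂ s) := by
      rw [Finset.sum_comm, Finset.mul_sum]
      refine Finset.sum_congr rfl fun s _ => ?_
      rw [← Finset.sum_mul, ← dAvg_mul_horizon G hπ₂]
      ring
    _ ≤ 2 * u * G.H * ε := mul_le_mul_of_nonneg_left hε (by positivity)
    _ = 2 * ε * u * G.H := by ring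

end MAIL
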